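/- Let q₁, q₂, q₃ ∈ Q_B, i.e., qᵢ = a_{i1}x₂x₃ + a_{i2}x₁x₃ + a_{i3}x₁x₂ with a_{i1}+a_{i2}+a_{i3} = 0 for i = 1,2,3. Then the Hessian matrix of the degree-6 product q₁q₂q₃ vanishes at all four points (0,0,1), (0,1,0), (1,0,0), (1,1,1); that is, q₁q₂q₃ ∈ S_B. -/

import Mathlib

open MvPolynomial

noncomputable section

/-- The Hessian matrix of `f` (the matrix of second partial derivatives) vanishes at `p`. -/
def HessVanishesAt (f : MvPolynomial (Fin 3) ℂ) (p : Fin 3 → ℂ) : Prop :=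
  ∀ i j : Fin 3, eval p (pderiv i (pderiv j f)) = 0

/-- The four points `[0:0:1]`, `[0:1:0]`, `[1:0:0]`, `[1:1:1]` of `ℙ²` in general position. -/
def Bpts : Set (Fin 3 → ℂ) := {![0,0,1], ![0,1,0], ![1,0,0], ![1,1,1]}

/-- The Hessian of a product of three polynomials vanishes at every common zero of the factors. -/
theorem hessVanishesAt_mul_mul {f g h : MvPolynomial (Fin 3) ℂ} {p : Fin 3 → ℂ}
    (hf : eval p f = 0) (hg : eval p g = 0) (hh : eval p h = 0) :
    HessVanishesAt (f * g * h) p := by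
  intro i j
  simp [Derivation.leibniz, hf, hg, hh]

/-- If `qᵢ = a_{i1} x₂x₃ + a_{i2} x₁x₃ + a_{i3} x₁x₂` with `a_{i1} + a_{i2} + a_{i3} = 0`
for `i = 1,2,3` (i.e. `q₁, q₂, q₃ ∈ Q_B`), then the Hessian matrix of the degree-6 product
`q₁q₂q₃` vanishes at all four points `(0,0,1)`, `(0,1,0)`, `(1,0,0)`, `(1,1,1)`;
that is, `q₁q₂q₃ ∈ S_B`. -/
theorem hessVanishesAt_product (a : Fin 3 → Fin 3 → ℂ)
    (hsum : ∀ i : Fin 3, a i 0 + a i 1 + a i 2 = 0)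
    (q : Fin 3 → MvPolynomial (Fin 3) ℂ)
    (hq : ∀ i : Fin 3,
      q i = C (a i 0) * (X 1 * X 2) + C (a i 1) * (X 0 * X 2) + C (a i 2) * (X 0 * X 1)) :
    ∀ p ∈ Bpts, HessVanishesAt (q 0 * q 1 * q 2) p := by
  intro p hp
  have hzero (i : Fin 3) : eval p (q i) = 0 := by
    rcases hp with rfl | rfl | rfl | rfl <;> simp [hq, hsum]
  exact hessVanishesAt_mul_mul (hzero 0) (hzero 1) (hzero 2)
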